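/- arXiv:2503.20260 — 3 statements merged into one kernel-verified Lean document; each statement's English description precedes it below -/
import Mathlib

section
/- Let G = (V, E) be the bipartite graph whose vertices on one side are all pairs (i, h) with i ∈ [n] an agent and h ∈ [k] a category, and on the other side the m items, with an edge between (i, h) and item j whenever j belongs to category S_h; assume |S_h| = n·s_h for all h. Let P be the polytope of x ∈ ℝ^E_{≥0} satisfying Σ_{e∈δ(j)} x_e = 1 for every item j and Σ_{e∈δ(i,h)} x_e = s_h for every pair (i, h). Then for every face F of P of dimension at most n−1, the number of edges e ∈ E such that x_e = 1 for every x ∈ F is at least m − n(n−1). -/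
/-- The transportation polytope of the bipartite graph whose edges are the pairs
`(agent-category vertex, item)`: an edge is encoded as a pair `(i, j)`, joining the vertex
`(i, cat j)` to the item `j`. The constraints are `Σ_{e ∈ δ(j)} x_e = 1` for every item `j`
and `Σ_{e ∈ δ(i,h)} x_e = s h` for every pair `(i, h)`, together with `x ≥ 0`. -/
def FracPolytope (n m k : ℕ) (cat : Fin m → Fin k) (s : Fin k → ℕ) :
    Set (Fin n × Fin m → ℝ) :=
  {x | (∀ e, 0 ≤ x e) ∧
       (∀ j : Fin m, ∑ i : Fin n, x (i, j) = 1) ∧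
       (∀ (i : Fin n) (h : Fin k), ∑ j ∈ Finset.univ.filter (fun j => cat j = h), x (i, j)
          = (s h : ℝ))}

/-- If `[0, 1]`-valued reals have an integral sum and one of them is not an integer,
then at least two of them are not integers. -/
theorem two_le_card_fractional {ι : Type*} [DecidableEq ι] (S : Finset ι) (x : ι → ℝ)
    (h0 : ∀ a ∈ S, 0 ≤ x a) (h1 : ∀ a ∈ S, x a ≤ 1) (N : ℕ) (hN : ∑ a ∈ S, x a = N)
    {b : ι} (hb : b ∈ S) (hb0 : x b ≠ 0) (hb1 : x b ≠ 1) :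
    2 ≤ (S.filter (fun a => x a ≠ 0 ∧ x a ≠ 1)).card := by
  by_contra! hlt
  have hbf : b ∈ S.filter (fun a => x a ≠ 0 ∧ x a ≠ 1) := by simp [hb, hb0, hb1]
  have huniq : ∀ a ∈ S.erase b, x a = ((if x a = 1 then 1 else 0 : ℤ) : ℝ) := by
    intro a ha
    obtain ⟨hab, haS⟩ := Finset.mem_erase.mp ha
    by_cases ha1 : x a = 1
    · simp [ha1]
    by_cases ha0 : x a = 0
    · simp [ha0]
    · exact absurd (Finset.card_le_one.mp (by omega) a (by simp [haS, ha0, ha1]) b hbf) hab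
  rw [← Finset.add_sum_erase S x hb, Finset.sum_congr rfl huniq, ← Int.cast_sum] at hN
  set z : ℤ := ∑ a ∈ S.erase b, if x a = 1 then 1 else 0
  have hxb : x b = (((N : ℤ) - z : ℤ) : ℝ) := by push_cast; linarith
  have hlo : 0 ≤ (N : ℤ) - z := by exact_mod_cast hxb ▸ h0 b hb
  have hhi : (N : ℤ) - z ≤ 1 := by exact_mod_cast hxb ▸ h1 b hb
  obtain h | h : (N : ℤ) - z = 0 ∨ (N : ℤ) - z = 1 := by omega
  · exact hb0 (by rw [hxb, h]; simp)
  · exact hb1 (by rw [hxb, h]; simp)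

/-- A nonnegative vector can be moved a little in both directions along any vector which
vanishes wherever it does. -/
theorem exists_pos_perturbation {ι : Type*} [Finite ι] (x d : ι → ℝ) (hx : ∀ e, 0 ≤ x e)
    (hd : ∀ e, x e = 0 → d e = 0) :
    ∃ ε : ℝ, 0 < ε ∧ (∀ e, 0 ≤ x e + ε * d e) ∧ ∀ e, 0 ≤ x e + -ε * d e := by
  have key : ∀ᶠ ε in nhds (0 : ℝ), ∀ e, 0 ≤ x e + ε * d e := by
    rw [Filter.eventually_all]
    intro e
    rcases (hx e).eq_or_lt with h | h
    · simp [hd e h.symm, ← h]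
    · have : Filter.Tendsto (fun ε : ℝ => x e + ε * d e) (nhds 0) (nhds (x e)) := by
        have hc : Continuous (fun ε : ℝ => x e + ε * d e) := by fun_prop
        simpa using hc.tendsto 0
      filter_upwards [Filter.Tendsto.eventually_const_lt h this] with ε hε using hε.le
  obtain ⟨r, hr, hball⟩ := Metric.eventually_nhds_iff.mp key
  refine ⟨r / 2, by positivity, hball ?_, hball ?_⟩ <;>
    · simp only [dist_zero_right, norm_neg, Real.norm_eq_abs]
      rw [abs_of_pos (by positivity)]
      linarith

/-- The face of `FracPolytope` on which the linear functional with coefficients `c` is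
maximal. -/
def FracFace (n m k : ℕ) (cat : Fin m → Fin k) (s : Fin k → ℕ) (c : Fin n × Fin m → ℝ) :
    Set (Fin n × Fin m → ℝ) :=
  {x ∈ FracPolytope n m k cat s |
    ∀ y ∈ FracPolytope n m k cat s, ∑ e, c e * y e ≤ ∑ e, c e * x e}

section

variable {n m k : ℕ} {cat : Fin m → Fin k} {s : Fin k → ℕ} {c x : Fin n × Fin m → ℝ}

theorem FracPolytope.le_one (hx : x ∈ FracPolytope n m k cat s) (e : Fin n × Fin m) :
    x e ≤ 1 := by
  rw [← hx.2.1 e.2]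
  exact Finset.single_le_sum (f := fun i => x (i, e.2)) (fun i _ => hx.1 _) (Finset.mem_univ e.1)

theorem FracFace.midpoint_mem {y : Fin n × Fin m → ℝ} (hx : x ∈ FracFace n m k cat s c)
    (hy : y ∈ FracFace n m k cat s c) :
    (fun e => (x e + y e) / 2) ∈ FracFace n m k cat s c := by
  refine ⟨⟨fun e => ?_, fun j => ?_, fun i h => ?_⟩, fun z hz => ?_⟩
  · have := hx.1.1 e
    have := hy.1.1 e
    positivity
  · rw [← Finset.sum_div, Finset.sum_add_distrib, hx.1.2.1, hy.1.2.1]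
    norm_num
  · rw [← Finset.sum_div, Finset.sum_add_distrib, hx.1.2.2, hy.1.2.2]
    ring
  · have h1 := hx.2 z hz
    have h2 := hy.2 z hz
    have : ∑ e, c e * ((x e + y e) / 2) = (∑ e, c e * x e + ∑ e, c e * y e) / 2 := by
      rw [← Finset.sum_add_distrib, Finset.sum_div]
      exact Finset.sum_congr rfl fun e _ => by ring
    rw [this]
    linarith

/-- A nonempty face has a point all of whose coordinates equal to `1` are equal to `1` on the
whole face. -/
theorem FracFace.exists_minimal_ones (hne : (FracFace n m k cat s c).Nonempty) :
    ∃ x ∈ FracFace n m k cat s c, ∀ e, x e = 1 → ∀ y ∈ FracFace n m k cat s c, y e = 1 := by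
  classical
  let ones : (Fin n × Fin m → ℝ) → Finset (Fin n × Fin m) :=
    fun x => Finset.univ.filter (fun e => x e = 1)
  obtain ⟨x, hmem, hmin⟩ := exists_minimalFor_of_wellFoundedLT
    (· ∈ FracFace n m k cat s c) (fun x => (ones x).card) hne
  refine ⟨x, hmem, fun e he y hy => ?_⟩
  by_contra hye
  refine not_lt_iff_le_imp_ge.mpr (hmin (midpoint_mem hmem hy)) (Finset.card_lt_card ?_)
  have hx1 := FracPolytope.le_one hmem.1
  have hy1 := FracPolytope.le_one hy.1
  rw [Finset.ssubset_iff_of_subset]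
  · refine ⟨e, by simpa [ones] using he, fun h => hye ?_⟩
    simp only [ones, Finset.mem_filter, Finset.mem_univ, true_and] at h
    linarith
  · intro a ha
    simp only [ones, Finset.mem_filter, Finset.mem_univ, true_and] at ha ⊢
    linarith [hx1 a, hy1 a]

/-- Circulations supported on the positive coordinates of a point of a face are directions
of that face. -/
theorem FracFace.mem_direction (hx : x ∈ FracFace n m k cat s c) (d : Fin n × Fin m → ℝ)
    (hd : ∀ e, x e = 0 → d e = 0) (hitem : ∀ j, ∑ i, d (i, j) = 0)
    (hagent : ∀ i h, ∑ j ∈ Finset.univ.filter (fun j => cat j = h), d (i, j) = 0) :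
    d ∈ (affineSpan ℝ (FracFace n m k cat s c)).direction := by
  obtain ⟨ε, hε, hpos, hneg⟩ := exists_pos_perturbation x d hx.1.1 hd
  have hP : ∀ r : ℝ, (∀ e, 0 ≤ x e + r * d e) →
      (fun e => x e + r * d e) ∈ FracPolytope n m k cat s := fun r hr =>
    ⟨hr, fun j => by rw [Finset.sum_add_distrib, ← Finset.mul_sum, hitem, hx.1.2.1]; simp,
      fun i h => by rw [Finset.sum_add_distrib, ← Finset.mul_sum, hagent, hx.1.2.2]; simp⟩
  have hval : ∀ r : ℝ, ∑ e, c e * (x e + r * d e) = ∑ e, c e * x e + r * ∑ e, c e * d e := by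
    intro r
    rw [Finset.mul_sum, ← Finset.sum_add_distrib]
    exact Finset.sum_congr rfl fun e _ => by ring
  have h2 := hx.2 _ (hP _ hneg)
  rw [hval] at h2
  have hmem : (fun e => x e + ε * d e) ∈ FracFace n m k cat s c :=
    ⟨hP _ hpos, fun y hy => (hx.2 y hy).trans (by rw [hval]; linarith)⟩
  have hsub := AffineSubspace.vsub_mem_direction (subset_affineSpan ℝ _ hmem)
    (subset_affineSpan ℝ _ hx)
  have heq : (fun e => x e + ε * d e) -ᵥ x = ε • d := by
    ext e
    simp
  rw [heq] at hsub
  simpa [smul_smul, inv_mul_cancel₀ hε.ne'] using Submodule.smul_mem _ ε⁻¹ hsub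

/-- The linear map sending a weighting of the edges in `Ef` to its sums around the items in
`T` and around the agent-category vertices in `A`. -/
noncomputable def vertexSums (cat : Fin m → Fin k) (Ef : Finset (Fin n × Fin m))
    (T : Finset (Fin m)) (A : Finset (Fin n × Fin k)) :
    (Ef → ℝ) →ₗ[ℝ] (T → ℝ) × (A → ℝ) :=
  LinearMap.prod
    (LinearMap.pi fun j => ∑ i, LinearMap.proj (i, j.1))
    (LinearMap.pi fun a => ∑ j ∈ Finset.univ.filter (fun j => cat j = a.1.2),
      LinearMap.proj (a.1.1, j)) ∘ₗ
  Function.ExtendByZero.linearMap ℝ (Subtype.val : Ef → Fin n × Fin m)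

/-- A lower bound on the dimension of a face, from the circulations on a set `Ef` of nonzero
edges of one of its points: in each category meeting `Ef`, one item constraint is redundant. -/
theorem FracFace.card_support_le (hx : x ∈ FracFace n m k cat s c)
    (Ef : Finset (Fin n × Fin m)) (hEf : ∀ e, e ∈ Ef → x e ≠ 0) :
    Ef.card + ((Ef.image Prod.snd).image cat).card ≤
      Module.finrank ℝ (affineSpan ℝ (FracFace n m k cat s c)).direction +
        (Ef.image Prod.snd).card + (Ef.image fun e => (e.1, cat e.2)).card := by
  classical
  set T := Ef.image Prod.snd with hT
  set A := Ef.image fun e => (e.1, cat e.2) with hA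
  obtain ⟨R, hRT, hRcard, hRinj⟩ : ∃ R ⊆ T, R.card = (T.image cat).card ∧
      Set.InjOn cat R := by
    obtain ⟨R, hRT, hRinj, hRim⟩ := Finset.exists_subset_injOn_image_eq_of_surjOn (f := cat)
      (T : Set (Fin m)) (T.image cat) (by simp [Set.surjOn_image])
    exact ⟨R, by exact_mod_cast hRT, by rw [← hRim, Finset.card_image_of_injOn hRinj], hRinj⟩
  let ext := Function.ExtendByZero.linearMap ℝ (Subtype.val : Ef → Fin n × Fin m)
  have hext0 : ∀ f e, e ∉ Ef → ext f e = 0 := by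
    intro f e he
    exact Function.extend_apply' _ _ _ (by rintro ⟨a, rfl⟩; exact he a.2)
  have hinj : Function.Injective ext := by
    intro f g hfg
    ext a
    have : Function.extend Subtype.val f 0 a.1 = Function.extend Subtype.val g 0 a.1 :=
      congrFun hfg a.1
    simpa only [Subtype.val_injective.extend_apply] using this
  let L := vertexSums cat Ef (T \ R) A
  have hle : (LinearMap.ker L).map ext ≤
      (affineSpan ℝ (FracFace n m k cat s c)).direction := by
    rintro _ ⟨f, hf, rfl⟩
    have hfL : L f = 0 := hf
    have hitem' : ∀ j ∈ T \ R, ∑ i, ext f (i, j) = 0 := by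
      intro j hj
      have := congrFun (congrArg Prod.fst hfL) ⟨j, hj⟩
      simpa [L, ext, vertexSums, Function.ExtendByZero.linearMap] using this
    have hagent : ∀ i h, ∑ j ∈ Finset.univ.filter (fun j => cat j = h), ext f (i, j) = 0 := by
      intro i h
      by_cases hih : (i, h) ∈ A
      · have := congrFun (congrArg Prod.snd hfL) ⟨(i, h), hih⟩
        simpa [L, ext, vertexSums, Function.ExtendByZero.linearMap] using this
      · refine Finset.sum_eq_zero fun j hj => hext0 f _ fun he => hih ?_
        exact Finset.mem_image.mpr ⟨_, he, by simpa using hj⟩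
    have hitem'' : ∀ j ∉ R, ∑ i, ext f (i, j) = 0 := by
      intro j hj
      by_cases hjT : j ∈ T
      · exact hitem' j (by simp [hj, hjT])
      · exact Finset.sum_eq_zero fun i _ => hext0 f _ fun he =>
          hjT (Finset.mem_image.mpr ⟨_, he, rfl⟩)
    refine mem_direction hx _ (fun e he => hext0 f e fun h => hEf e h he) (fun j => ?_) hagent
    by_cases hjR : j ∈ R
    · have htot : ∑ j' ∈ Finset.univ.filter (fun j' => cat j' = cat j),
          ∑ i, ext f (i, j') = 0 := by
        rw [Finset.sum_comm]
        exact Finset.sum_eq_zero fun i _ => hagent i _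
      rwa [Finset.sum_eq_single_of_mem j (by simp)] at htot
      intro j' hj' hne
      exact hitem'' j' fun h => hne (hRinj h hjR (by simpa using hj'))
    · exact hitem'' j hjR
  have h1 := Submodule.finrank_mono hle
  rw [← (Submodule.equivMapOfInjective ext hinj _).finrank_eq] at h1
  have h2 := L.finrank_range_add_finrank_ker
  have h3 := (LinearMap.range L).finrank_le
  simp only [Module.finrank_prod, Module.finrank_fintype_fun_eq_card, Fintype.card_coe] at h2 h3
  have h4 := Finset.card_sdiff_add_card_eq_card hRT
  omega

end

/-- For every face of the transportation polytope of dimension at most `n − 1` (a face being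
the set of maximizers of a linear functional), at least `m − n(n−1)` of the variables `x_e`
are fixed to `1` on the face. -/
theorem statement9 (n m k : ℕ) (cat : Fin m → Fin k) (s : Fin k → ℕ)
    (hcap : ∀ h : Fin k, (Finset.univ.filter (fun j => cat j = h)).card = n * s h)
    (c : Fin n × Fin m → ℝ) (F : Set (Fin n × Fin m → ℝ))
    (hF : F = {x ∈ FracPolytope n m k cat s |
      ∀ y ∈ FracPolytope n m k cat s, ∑ e, c e * y e ≤ ∑ e, c e * x e})
    (hdim : Module.finrank ℝ (affineSpan ℝ F).direction ≤ n - 1) :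
    m - n * (n - 1) ≤ {e : Fin n × Fin m | ∀ x ∈ F, x e = 1}.ncard := by
  classical
  obtain rfl | hn := Nat.eq_zero_or_pos n
  · have hm : m = 0 := by
      by_contra hm
      have := hcap (cat ⟨0, Nat.pos_of_ne_zero hm⟩)
      rw [zero_mul, Finset.card_eq_zero] at this
      exact Finset.eq_empty_iff_forall_notMem.mp this ⟨0, Nat.pos_of_ne_zero hm⟩ (by simp)
    omega
  change F = FracFace n m k cat s c at hF
  subst hF
  rcases (FracFace n m k cat s c).eq_empty_or_nonempty with hempty | hne
  · simp only [hempty, Set.mem_empty_iff_false, false_imp_iff, implies_true, Set.ofPred_true,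
      Set.ncard_univ, Nat.card_eq_fintype_card, Fintype.card_prod, Fintype.card_fin]
    exact (Nat.sub_le _ _).trans (Nat.le_mul_of_pos_left m hn)
  obtain ⟨x, hx, hones⟩ := FracFace.exists_minimal_ones hne
  set Ef : Finset (Fin n × Fin m) := Finset.univ.filter (fun e => x e ≠ 0 ∧ x e ≠ 1) with hEf
  have hrank := FracFace.card_support_le hx Ef (fun e he => (Finset.mem_filter.mp he).2.1)
  set T := Ef.image Prod.snd with hT
  set A := Ef.image fun e => (e.1, cat e.2) with hA
  set Q := T.image cat with hQ
  have hle1 := FracPolytope.le_one hx.1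
  have hT2 : 2 * T.card ≤ Ef.card := by
    refine Finset.mul_card_image_le_card Ef 2 fun j hj => ?_
    obtain ⟨⟨i, j⟩, he, rfl⟩ := Finset.mem_image.mp hj
    have he' := (Finset.mem_filter.mp he).2
    have := two_le_card_fractional (Finset.univ : Finset (Fin n)) (fun i => x (i, j))
      (fun i _ => hx.1.1 _) (fun i _ => hle1 _) 1 (by simpa using hx.1.2.1 j)
      (Finset.mem_univ i) he'.1 he'.2
    refine this.trans (Finset.card_le_card_of_injOn (fun i => (i, j)) ?_ ?_)
    · intro a ha
      simpa [hEf] using ha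
    · intro a _ b _ hab
      simpa using hab
  have hA2 : 2 * A.card ≤ Ef.card := by
    refine Finset.mul_card_image_le_card Ef 2 fun a ha => ?_
    obtain ⟨⟨i, j⟩, he, rfl⟩ := Finset.mem_image.mp ha
    have he' := (Finset.mem_filter.mp he).2
    have := two_le_card_fractional (Finset.univ.filter fun j' => cat j' = cat j)
      (fun j => x (i, j)) (fun _ _ => hx.1.1 _) (fun _ _ => hle1 _) (s (cat j))
      (hx.1.2.2 i (cat j)) (b := j) (by simp) he'.1 he'.2
    refine this.trans (Finset.card_le_card_of_injOn (fun j => (i, j)) ?_ ?_)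
    · intro a ha
      simp only [Finset.coe_filter, Finset.mem_filter, Finset.mem_univ, true_and,
        Set.mem_ofPred_eq] at ha
      simp [hEf, ha]
    · intro a _ b _ hab
      simpa using hab
  have hAQ : A.card ≤ n * Q.card := by
    have hsub : A ⊆ Finset.univ ×ˢ Q := by
      intro a ha
      obtain ⟨e, he, rfl⟩ := Finset.mem_image.mp ha
      simp only [Finset.mem_product, Finset.mem_univ, true_and]
      exact Finset.mem_image_of_mem _ (Finset.mem_image_of_mem _ he)
    simpa using Finset.card_le_card hsub
  have hTle : T.card ≤ n * (n - 1) := by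
    obtain ⟨p, rfl⟩ : ∃ p, n = p + 1 := ⟨n - 1, by omega⟩
    simp only [Nat.add_sub_cancel] at hdim ⊢
    have hQp : Q.card ≤ p := by omega
    nlinarith [Nat.mul_le_mul_left p hQp]
  have hint : ∀ j ∉ T, ∃ i, x (i, j) = 1 := by
    intro j hj
    by_contra! hno
    have hzero : ∀ i, x (i, j) = 0 := by
      intro i
      by_contra h0
      exact hj (Finset.mem_image.mpr ⟨(i, j), by simp [hEf, h0, hno i], rfl⟩)
    simpa [hzero] using hx.1.2.1 j
  have hsub : ((Tᶜ : Finset (Fin m)) : Set (Fin m)) ⊆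
      Prod.snd '' {e : Fin n × Fin m | ∀ y ∈ FracFace n m k cat s c, y e = 1} := by
    intro j hj
    obtain ⟨i, hi⟩ := hint j (by simpa using hj)
    exact ⟨(i, j), hones _ hi, rfl⟩
  have hcard := (Set.ncard_le_ncard hsub (Set.toFinite _)).trans
    (Set.ncard_image_le (Set.toFinite _))
  rw [Set.ncard_coe_finset, Finset.card_compl, Fintype.card_fin] at hcard
  omega
end

section
/- Let G = (V, E) be the bipartite graph with one side the pairs (i, h), i ∈ [n], h ∈ [k], the other side the items [m], and an edge between (i, h) and j whenever j ∈ S_h; assume |S_h| = n·s_h for all h. Consider the linear program maximizing Σ_{e∈E} c_e x_e over x ∈ ℝ^E_{≥0} with Σ_{e∈δ(j)} x_e = 1 for every item j and Σ_{e∈δ(i,h)} x_e = s_h for every pair (i,h). For an elementary cycle C of G with edges e_1, e_2, …, e_ℓ in cyclic order (ℓ is even since G is bipartite), write σ_C(c) = c_{e_1} − c_{e_2} + c_{e_3} − ⋯ − c_{e_ℓ}. Let c¹, c² ∈ ℝ^E be two cost vectors such that for every elementary cycle C and every cyclic traversal of it: σ_C(c¹)·σ_C(c²) ≥ 0, and σ_C(c¹)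 = 0 implies σ_C(c²) = 0 (i.e., the supporting cell of c¹ in the arrangement of the hyperplanes {σ_C = 0} contains that of c²). Then every optimal solution of the linear program with objective c¹ is also an optimal solution with objective c². -/
/-- The alternating sum `σ_C(c) = c_{e_1} − c_{e_2} + ⋯ − c_{e_{2p}}` of a cost vector `c`
along the elementary cycle `C` of the bipartite graph that alternates between the vertices
`(ι 0, cat (J 0)), J 0, (ι 1, cat (J 1)), J 1, …, (ι (p-1), cat (J (p-1))), J (p-1)`,
whose edges are `e_{2t+1} = (ι t, J t)` and `e_{2t+2} = (ι ((t+1) % p), J t)`. -/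
def cycleSum {n m : ℕ} (c : Fin n × Fin m → ℝ) (p : ℕ) (ι : ℕ → Fin n) (J : ℕ → Fin m) : ℝ :=
  ∑ t ∈ Finset.range p, (c (ι t, J t) - c (ι ((t + 1) % p), J t))

/-- A signed edge weighting whose net flow vanishes at every item and at every pair
`(i, h)`. -/
def IsCirculation {n m k : ℕ} (cat : Fin m → Fin k) (d : Fin n × Fin m → ℝ) : Prop :=
  (∀ j, ∑ i, d (i, j) = 0) ∧
    ∀ i h, ∑ j ∈ Finset.univ.filter (fun j => cat j = h), d (i, j) = 0

/-- `(p, ι, J)` is an elementary cycle whose odd edges have positive weight and whose even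
edges have negative weight. -/
structure IsConformalCycle {n m k : ℕ} (cat : Fin m → Fin k) (d : Fin n × Fin m → ℝ)
    (p : ℕ) (ι : ℕ → Fin n) (J : ℕ → Fin m) : Prop where
  two_le : 2 ≤ p
  inj_agent : ∀ t t', t < p → t' < p → ι t = ι t' → t = t'
  inj_item : ∀ t t', t < p → t' < p → J t = J t' → t = t'
  cat_eq : ∀ t t', t < p → t' < p → cat (J t) = cat (J t')
  pos : ∀ t, t < p → 0 < d (ι t, J t)
  neg : ∀ t, t < p → d (ι ((t + 1) % p), J t) < 0

lemma Finset.sum_range_succ_mod {M : Type*} [AddCommMonoid M] (p : ℕ) (F : ℕ → M) :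
    ∑ t ∈ Finset.range p, F ((t + 1) % p) = ∑ t ∈ Finset.range p, F t := by
  cases p with
  | zero => simp
  | succ q =>
    rw [Finset.sum_range_succ, Finset.sum_range_succ' F, Nat.mod_self]
    congr 1
    refine Finset.sum_congr rfl fun t ht => ?_
    rw [Nat.mod_eq_of_lt (by have := Finset.mem_range.1 ht; omega)]

lemma Function.periodicPts_nonempty {α : Type*} [Finite α] [Nonempty α] (g : α → α) :
    (Function.periodicPts g).Nonempty := by
  obtain ⟨a⟩ := ‹Nonempty α›
  obtain ⟨u, v, huv, h⟩ := Finite.exists_ne_map_eq_of_infinite (fun t : ℕ => g^[t] a)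
  wlog hlt : u < v generalizing u v
  · exact this v u huv.symm h.symm (by omega)
  refine ⟨g^[u] a, Function.mk_mem_periodicPts (n := v - u) (by omega) ?_⟩
  change g^[v - u] (g^[u] a) = g^[u] a
  rw [← Function.iterate_add_apply, Nat.sub_add_cancel hlt.le]
  exact h.symm

section Circulation

variable {n m k : ℕ} {cat : Fin m → Fin k} {d : Fin n × Fin m → ℝ}

lemma IsCirculation.exists_neg_item (hd : IsCirculation cat d) {i : Fin n} {j : Fin m}
    (h : 0 < d (i, j)) : ∃ i', d (i', j) < 0 := by
  by_contra! hcon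
  exact h.ne' ((Finset.sum_eq_zero_iff_of_nonneg fun i' _ => hcon i').1 (hd.1 j) i
    (Finset.mem_univ i))

lemma IsCirculation.exists_pos_item (hd : IsCirculation cat d) {i : Fin n} {j : Fin m}
    (h : d (i, j) < 0) : ∃ i', 0 < d (i', j) := by
  by_contra! hcon
  exact h.ne ((Finset.sum_eq_zero_iff_of_nonpos fun i' _ => hcon i').1 (hd.1 j) i
    (Finset.mem_univ i))

lemma IsCirculation.exists_pos_agent (hd : IsCirculation cat d) {i : Fin n} {j : Fin m}
    (h : d (i, j) < 0) : ∃ j', cat j' = cat j ∧ 0 < d (i, j') := by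
  by_contra! hcon
  refine h.ne ((Finset.sum_eq_zero_iff_of_nonpos fun j' hj' => ?_).1 (hd.2 i (cat j)) j ?_)
  · exact hcon j' (Finset.mem_filter.1 hj').2
  · simp

lemma IsCirculation.exists_conformalCycle (hd : IsCirculation cat d) (hne : d ≠ 0) :
    ∃ p ι J, IsConformalCycle cat d p ι J := by
  obtain ⟨i₀, j₀, h₀⟩ : ∃ i j, 0 < d (i, j) := by
    obtain ⟨⟨i, j⟩, he⟩ := Function.ne_iff.1 hne
    rcases lt_or_gt_of_ne he with h | h
    · obtain ⟨i', hi'⟩ := hd.exists_pos_item h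
      exact ⟨i', j, hi'⟩
    · exact ⟨i, j, h⟩
  let A := {i : Fin n // ∃ j, cat j = cat j₀ ∧ 0 < d (i, j)}
  choose b hb_cat hb_pos using fun a : A => a.2
  have : Nonempty A := ⟨⟨i₀, j₀, rfl, h₀⟩⟩
  have hstep : ∀ j, ∃ a' : A, ∀ a, b a = j → d (a'.1, j) < 0 := fun j => by
    by_cases hj : ∃ a, b a = j
    · obtain ⟨a, rfl⟩ := hj
      obtain ⟨i', hi'⟩ := hd.exists_neg_item (hb_pos a)
      obtain ⟨j', hj', hpos⟩ := hd.exists_pos_agent hi'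
      exact ⟨⟨i', j', hj'.trans (hb_cat a), hpos⟩, fun _ _ => hi'⟩
    · exact ⟨Classical.arbitrary A, fun a ha => (hj ⟨a, ha⟩).elim⟩
  choose f hf using hstep
  let g : A → A := fun a => f (b a)
  have hg_neg : ∀ a, d ((g a).1, b a) < 0 := fun a => hf _ a rfl
  obtain ⟨a, ha⟩ := Function.periodicPts_nonempty g
  have hp := Function.minimalPeriod_pos_of_mem_periodicPts ha
  set p := Function.minimalPeriod g a with hp_def
  have hmod : ∀ t, g^[t % p] a = g^[t] a := fun t => Function.iterate_mod_minimalPeriod_eq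
  have hinj : ∀ t t', t < p → t' < p → g^[t] a = g^[t'] a → t = t' := fun t t' ht ht' h =>
    (Function.iterate_eq_iterate_iff_of_lt_minimalPeriod ht ht').1 h
  have hneg : ∀ t, d ((g^[(t + 1) % p] a).1, b (g^[t] a)) < 0 := fun t => by
    rw [hmod, Function.iterate_succ_apply']
    exact hg_neg _
  refine ⟨p, fun t => (g^[t] a).1, fun t => b (g^[t] a), ?_, ?_, ?_, ?_, ?_, ?_⟩
  · by_contra hlt
    have hp1 : p = 1 := by omega
    have h := hneg 0
    rw [hp1] at h
    exact lt_asymm h (hb_pos a)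
  · exact fun t t' ht ht' h => hinj t t' ht ht' (Subtype.ext h)
  · intro t t' ht ht' h
    have h1 : g _ = g _ := congrArg f h
    rw [← Function.iterate_succ_apply' g, ← Function.iterate_succ_apply' g] at h1
    have h2 : t + 1 ≡ t' + 1 [MOD p] := by
      refine hinj _ _ (Nat.mod_lt _ hp) (Nat.mod_lt _ hp) ?_
      rw [hmod, hmod]
      exact h1
    have h3 : t ≡ t' [MOD p] := Nat.ModEq.add_right_cancel' 1 h2
    exact Nat.ModEq.eq_of_lt_of_lt h3 ht ht'
  · intro t t' _ _
    simp only [hb_cat]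
  · exact fun t _ => hb_pos _
  · exact fun t _ => hneg t

lemma isCirculation_iff_sum_mul : IsCirculation cat d ↔
    (∀ j, ∑ e, (if e.2 = j then 1 else 0) * d e = 0) ∧
      ∀ i h, ∑ e, (if e.1 = i ∧ cat e.2 = h then 1 else 0) * d e = 0 := by
  simp only [IsCirculation, Fintype.sum_prod_type, ite_mul, one_mul, zero_mul, ite_and,
    Finset.sum_ite_eq', Finset.sum_filter, Finset.mem_univ, if_true]
  refine and_congr Iff.rfl (forall₂_congr fun i h => ?_)
  rw [Finset.sum_eq_single i (fun i' _ hi' => by simp [hi']) (by simp)]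
  simp

lemma cycleSum_item {p : ℕ} {ι : ℕ → Fin n} {J : ℕ → Fin m} (j : Fin m) :
    cycleSum (fun e => if e.2 = j then 1 else 0) p ι J = 0 := by
  simp [cycleSum]

lemma IsConformalCycle.cycleSum_agent {p : ℕ} {ι : ℕ → Fin n} {J : ℕ → Fin m}
    (hC : IsConformalCycle cat d p ι J) (i : Fin n) (h : Fin k) :
    cycleSum (fun e => if e.1 = i ∧ cat e.2 = h then 1 else 0) p ι J = 0 := by
  have hp : 0 < p := by have := hC.two_le; omega
  rw [cycleSum, Finset.sum_sub_distrib, sub_eq_zero]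
  have key : ∀ f : ℕ → ℕ,
      ∑ t ∈ Finset.range p, (if ι (f t) = i ∧ cat (J t) = h then (1 : ℝ) else 0) =
        ∑ t ∈ Finset.range p, if ι (f t) = i ∧ cat (J 0) = h then 1 else 0 := fun f =>
    Finset.sum_congr rfl fun t ht => by rw [hC.cat_eq t 0 (Finset.mem_range.1 ht) hp]
  rw [key fun t => t, key fun t => (t + 1) % p]
  exact (Finset.sum_range_succ_mod p
    (fun t => if ι t = i ∧ cat (J 0) = h then (1 : ℝ) else 0)).symm

/-- Cancelling as much as possible of a circulation along a conformal cycle. -/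
lemma IsConformalCycle.exists_reduction {p : ℕ} {ι : ℕ → Fin n} {J : ℕ → Fin m}
    (hC : IsConformalCycle cat d p ι J) (hd : IsCirculation cat d) :
    ∃ (r : ℝ) (d' : Fin n × Fin m → ℝ), 0 < r ∧ IsCirculation cat d' ∧
      (∀ w, ∑ e, w e * d' e = ∑ e, w e * d e - r * cycleSum w p ι J) ∧
      (∀ e, 0 ≤ d e → 0 ≤ d' e ∧ d' e ≤ d e) ∧ (∀ e, d e ≤ 0 → d e ≤ d' e ∧ d' e ≤ 0) ∧
      ∃ e, d e ≠ 0 ∧ d' e = 0 := by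
  classical
  let P := (Finset.range p).image fun t => (ι t, J t)
  let N := (Finset.range p).image fun t => (ι ((t + 1) % p), J t)
  have hP : ∀ e ∈ P, 0 < d e := by
    intro e he
    obtain ⟨t, ht, rfl⟩ := Finset.mem_image.1 he
    exact hC.pos t (Finset.mem_range.1 ht)
  have hN : ∀ e ∈ N, d e < 0 := by
    intro e he
    obtain ⟨t, ht, rfl⟩ := Finset.mem_image.1 he
    exact hC.neg t (Finset.mem_range.1 ht)
  have hne : (P ∪ N).Nonempty := by
    have h0 : 0 < p := by have := hC.two_le; omega
    exact ⟨_, Finset.mem_union_left _ (Finset.mem_image_of_mem _ (Finset.mem_range.2 h0))⟩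
  obtain ⟨e₀, he₀, hmin⟩ := Finset.exists_min_image (P ∪ N) (fun e => |d e|) hne
  have hd₀ : d e₀ ≠ 0 := by
    rcases Finset.mem_union.1 he₀ with h | h
    · exact (hP _ h).ne'
    · exact (hN _ h).ne
  let χ : Fin n × Fin m → ℝ := fun e => (if e ∈ P then 1 else 0) - (if e ∈ N then 1 else 0)
  have hχ : ∀ w, ∑ e, w e * χ e = cycleSum w p ι J := by
    intro w
    simp only [χ, mul_sub, Finset.sum_sub_distrib, mul_ite, mul_one, mul_zero,
      Finset.sum_ite_mem, Finset.univ_inter, cycleSum]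
    congr 1
    · refine Finset.sum_image fun t ht t' ht' h => ?_
      exact hC.inj_item t t' (by simpa using ht) (by simpa using ht') (Prod.ext_iff.1 h).2
    · refine Finset.sum_image fun t ht t' ht' h => ?_
      exact hC.inj_item t t' (by simpa using ht) (by simpa using ht') (Prod.ext_iff.1 h).2
  have hχP : ∀ e ∈ P, χ e = 1 := fun e he => by
    have : e ∉ N := fun h => lt_asymm (hP e he) (hN e h)
    simp [χ, he, this]
  have hχN : ∀ e ∈ N, χ e = -1 := fun e he => by
    have : e ∉ P := fun h => lt_asymm (hP e h) (hN e he)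
    simp [χ, he, this]
  have hχ0 : ∀ e, e ∉ P → e ∉ N → χ e = 0 := fun e h h' => by simp [χ, h, h']
  have hr : 0 < |d e₀| := abs_pos.2 hd₀
  have hsum : ∀ w, ∑ e, w e * (d e - |d e₀| * χ e) =
      ∑ e, w e * d e - |d e₀| * cycleSum w p ι J := by
    intro w
    rw [← hχ w, Finset.mul_sum, ← Finset.sum_sub_distrib]
    exact Finset.sum_congr rfl fun e _ => by ring
  refine ⟨|d e₀|, fun e => d e - |d e₀| * χ e, hr, ?_, hsum, ?_, ?_, e₀, hd₀, ?_⟩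
  · rw [isCirculation_iff_sum_mul] at hd ⊢
    refine ⟨fun j => ?_, fun i h => ?_⟩
    · rw [hsum, hd.1, cycleSum_item]; simp
    · rw [hsum, hd.2, hC.cycleSum_agent]; simp
  · intro e he
    beta_reduce
    by_cases h : e ∈ P
    · have := hmin e (Finset.mem_union_left _ h)
      rw [abs_of_nonneg he] at this
      rw [hχP e h]
      constructor <;> linarith
    · rw [hχ0 e h fun h' => (hN e h').not_ge he]
      simpa using he
  · intro e he
    beta_reduce
    by_cases h : e ∈ N
    · have := hmin e (Finset.mem_union_right _ h)
      rw [abs_of_nonpos he] at this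
      rw [hχN e h]
      constructor <;> linarith
    · rw [hχ0 e (fun h' => (hP e h').not_ge he) h]
      simpa using he
  · beta_reduce
    rcases Finset.mem_union.1 he₀ with h | h
    · rw [hχP _ h, abs_of_pos (hP _ h)]; ring
    · rw [hχN _ h, abs_of_neg (hN _ h)]; ring

/-- A linear functional that is nonpositive on all conformal cycles of a circulation is
nonpositive on the circulation. -/
lemma IsCirculation.sum_mul_nonpos (w : Fin n × Fin m → ℝ) (hd : IsCirculation cat d)
    (hw : ∀ p ι J, IsConformalCycle cat d p ι J → cycleSum w p ι J ≤ 0) :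
    ∑ e, w e * d e ≤ 0 := by
  induction hN : (Finset.univ.filter fun e => d e ≠ 0).card using Nat.strong_induction_on
    generalizing d with
  | _ N ih =>
    by_cases h0 : d = 0
    · simp [h0]
    obtain ⟨p, ι, J, hC⟩ := hd.exists_conformalCycle h0
    obtain ⟨r, d', hr, hd', hsum, hpos, hneg, e, he, he'⟩ := hC.exists_reduction hd
    have hlt : (Finset.univ.filter fun e => d' e ≠ 0).card < N := by
      rw [← hN]
      refine Finset.card_lt_card (Finset.ssubset_iff_of_subset ?_ |>.2 ⟨e, by simpa, by simpa⟩)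
      refine Finset.monotone_filter_right _ fun a _ ha h => ha ?_
      exact le_antisymm (hneg a h.le).2 (hpos a h.ge).1
    have hle : ∑ e, w e * d' e ≤ 0 := by
      refine ih _ hlt hd' (fun p ι J hC' => hw p ι J ?_) rfl
      refine ⟨hC'.two_le, hC'.inj_agent, hC'.inj_item, hC'.cat_eq, fun t ht => ?_,
        fun t ht => ?_⟩
      · by_contra! h
        exact (hC'.pos t ht).not_ge (hneg _ h).2
      · by_contra! h
        exact (hC'.neg t ht).not_ge (hpos _ h).1
    have := mul_nonpos_of_nonneg_of_nonpos hr.le (hw p ι J hC)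
    linarith [hsum w]

end Circulation

/-- If the supporting cell of `c₁` in the arrangement of the hyperplanes `{σ_C = 0}`
(over all elementary cycles `C` of the bipartite graph) contains that of `c₂`, then every
optimal solution of the transportation LP for the objective `c₁` is optimal for `c₂`. -/
theorem statement10 (n m k : ℕ) (cat : Fin m → Fin k) (s : Fin k → ℕ)
    (hcap : ∀ h : Fin k, (Finset.univ.filter (fun j => cat j = h)).card = n * s h)
    (c₁ c₂ : Fin n × Fin m → ℝ)
    (hcycles : ∀ (p : ℕ), 2 ≤ p → ∀ (ι : ℕ → Fin n) (J : ℕ → Fin m),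
      (∀ t t', t < p → t' < p → ι t = ι t' → t = t') →
      (∀ t t', t < p → t' < p → J t = J t' → t = t') →
      (∀ t t', t < p → t' < p → cat (J t) = cat (J t')) →
      0 ≤ cycleSum c₁ p ι J * cycleSum c₂ p ι J ∧
        (cycleSum c₁ p ι J = 0 → cycleSum c₂ p ι J = 0))
    (x : Fin n × Fin m → ℝ) (hx : x ∈ FracPolytope n m k cat s)
    (hxopt : ∀ y ∈ FracPolytope n m k cat s, ∑ e, c₁ e * y e ≤ ∑ e, c₁ e * x e) :
    ∀ y ∈ FracPolytope n m k cat s, ∑ e, c₂ e * y e ≤ ∑ e, c₂ e * x e := by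
  intro y hy
  have hd : IsCirculation cat (fun e => y e - x e) := by
    refine ⟨fun j => ?_, fun i h => ?_⟩
    · rw [Finset.sum_sub_distrib, hy.2.1, hx.2.1, sub_self]
    · rw [Finset.sum_sub_distrib, hy.2.2, hx.2.2, sub_self]
  suffices h : ∑ e, c₂ e * (y e - x e) ≤ 0 by
    simp only [mul_sub, Finset.sum_sub_distrib] at h
    linarith
  refine hd.sum_mul_nonpos c₂ fun p ι J hC => ?_
  obtain ⟨r, d', hr, hd', hsum, hpos, hneg, -⟩ := hC.exists_reduction hd
  have hz : (fun e => y e - d' e) ∈ FracPolytope n m k cat s := by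
    refine ⟨fun e => ?_, fun j => ?_, fun i h => ?_⟩
    · rcases le_total 0 (y e - x e) with h | h
      · linarith [(hpos e h).2, hx.1 e]
      · linarith [(hneg e h).2, hy.1 e]
    · rw [Finset.sum_sub_distrib, hy.2.1, hd'.1, sub_zero]
    · rw [Finset.sum_sub_distrib, hy.2.2, hd'.2, sub_zero]
  have hσ₁ : cycleSum c₁ p ι J ≤ 0 := by
    have hopt := hxopt _ hz
    have hs := hsum c₁
    simp only [mul_sub, Finset.sum_sub_distrib] at hopt hs
    exact nonpos_of_mul_nonpos_right (a := r) (by linarith) hr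
  obtain ⟨hmul, hzero⟩ :=
    hcycles p hC.two_le ι J hC.inj_agent hC.inj_item hC.cat_eq
  rcases hσ₁.eq_or_lt with h | h
  · exact (hzero h).le
  · exact nonpos_of_mul_nonneg_right hmul h
end

section
/- Let c^1, …, c^q ∈ ℤ^d, let M be an r×d integer matrix and b ∈ ℤ^r, and let C be the q×d integer matrix whose i-th row is c^i. Define ‖C‖_∞ as the maximum absolute value of an entry of C (taken to be 1 if C = 0), ‖M‖_∞ likewise as the maximum absolute value of an entry of M (taken to be 1 if M = 0), θ' = (q+1)!·((r+1)!)^q·‖C‖_∞^q·‖M‖_∞^{rq}, and θ = max(2, θ'). Then for every rational α with 0 < α < 1, the rationals ε_s = (α/(dθ))^s for s ∈ [d] satisfy 0 < ε_s < α and the following: for every point t' of the (q−1)-dimensional standard simplex, the set of optimal solutions of the linear program max c(t')·x subject to Mx = b, x ∈ ℝ^d_{≥0}, where c_s(t') = Σ_{i=1}^q t'_i·c^i_s + ε_s, has affine dimension at most q−1 (whenever it is nonempty). -/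
/-- Feasibility for the linear program `max c·x s.t. Mx = b, x ≥ 0`. -/
def LPFeasible {r d : ℕ} (M : Matrix (Fin r) (Fin d) ℝ) (b : Fin r → ℝ) (x : Fin d → ℝ) : Prop :=
  (∀ i, ∑ s, M i s * x s = b i) ∧ ∀ s, 0 ≤ x s

/-- The optimal face of the linear program `max c·x s.t. Mx = b, x ≥ 0`. -/
def OptimalFace {r d : ℕ} (M : Matrix (Fin r) (Fin d) ℝ) (b : Fin r → ℝ) (c : Fin d → ℝ) :
    Set (Fin d → ℝ) :=
  {x | LPFeasible M b x ∧ ∀ y, LPFeasible M b y → ∑ s, c s * y s ≤ ∑ s, c s * x s}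

/-- A determinant is bounded by `n!` times the product of bounds for its columns. -/
lemma abs_det_le_factorial_mul_prod {n : ℕ} (A : Matrix (Fin n) (Fin n) ℤ) (β : Fin n → ℤ)
    (h : ∀ i j, |A i j| ≤ β j) : |A.det| ≤ n.factorial * ∏ j, β j := by
  rw [Matrix.det_apply]
  calc |∑ τ : Equiv.Perm (Fin n), Equiv.Perm.sign τ • ∏ i, A (τ i) i|
      ≤ ∑ τ : Equiv.Perm (Fin n), |Equiv.Perm.sign τ • ∏ i, A (τ i) i| :=
        Finset.abs_sum_le_sum_abs _ _
    _ ≤ ∑ _τ : Equiv.Perm (Fin n), ∏ j, β j := by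
        refine Finset.sum_le_sum fun τ _ => ?_
        have h1 : |Equiv.Perm.sign τ • ∏ i, A (τ i) i| = |∏ i, A (τ i) i| := by
          rcases Int.units_eq_one_or (Equiv.Perm.sign τ) with h | h <;> simp [h]
        rw [h1, Finset.abs_prod]
        exact Finset.prod_le_prod (fun _ _ => abs_nonneg _) fun _ _ => h _ _
    _ = n.factorial * ∏ j, β j := by
        simp [Fintype.card_perm]

/-- Integral kernel vectors from a maximal nonvanishing minor: on the columns `S` there is a set
`R` of at most `m` columns on which kernel vectors supported in `S` are determined by their
coordinates outside `R`, and each further column `s ∈ S` carries a kernel vector supported on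
`insert s R` whose entries are minors up to sign. -/
lemma exists_integral_circuits {m : ℕ} {σ : Type*} [Fintype σ] [DecidableEq σ]
    (N : Matrix (Fin m) σ ℤ) (β : σ → ℤ) (hβ : ∀ i x, |N i x| ≤ β x) (hβ1 : ∀ x, 1 ≤ β x)
    (S : Finset σ) :
    ∃ (R : Finset σ) (v : σ → σ → ℤ), R.card ≤ m ∧
      (∀ u : σ → ℝ, (∀ x, x ∉ S → u x = 0) → (∀ i, ∑ x, (N i x : ℝ) * u x = 0) →
        (∀ x, x ∈ S \ R → u x = 0) → u = 0) ∧
      ∀ s ∈ S \ R, v s s ≠ 0 ∧ (∀ x, x ≠ s → x ∉ R → v s x = 0) ∧ R ⊆ S ∧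
        (∀ i, ∑ x, N i x * v s x = 0) ∧
        ∀ x, ∃ E : Finset σ, x ∉ E ∧ E.card ≤ m ∧
          |v s x| ≤ m.factorial * ∏ y ∈ E, β y := by
  classical
  let P : ℕ → Prop := fun p => ∃ (J : Fin p → Fin m) (T : Fin p → σ),
    (∀ k, T k ∈ S) ∧ (N.submatrix J T).det ≠ 0
  have hPm : ∀ p, P p → p ≤ m := by
    rintro p ⟨J, T, -, hd⟩
    have hJ : Function.Injective J := by
      intro a b hab
      by_contra hne
      exact hd (Matrix.det_zero_of_row_eq hne (by ext k; simp [hab]))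
    simpa using Fintype.card_le_of_injective J hJ
  have hP0 : P 0 := ⟨Fin.elim0, Fin.elim0, fun k => k.elim0, by simp⟩
  obtain ⟨p, hp, hmax⟩ : ∃ p, P p ∧ ¬ P (p + 1) := by
    by_contra! hcon
    have hall : ∀ p, P p := fun p => Nat.rec hP0 (fun k ih => hcon k ih) p
    have := hPm _ (hall (m + 1))
    omega
  have hpm := hPm p hp
  obtain ⟨J, T, hTS, hd⟩ := hp
  have hTinj : Function.Injective T := by
    intro a b hab
    by_contra hne
    exact hd (Matrix.det_zero_of_column_eq hne (by intro k; simp [hab]))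
  let T' : σ → Fin (p + 1) → σ := fun s => Fin.cons s T
  let a : σ → Fin (p + 1) → ℤ := fun s k =>
    (-1) ^ (k : ℕ) * (N.submatrix J (T' s ∘ k.succAbove)).det
  refine ⟨Finset.univ.image T, fun s x => ∑ k, if T' s k = x then a s k else 0, ?_, ?_, ?_⟩
  · exact Finset.card_image_le.trans (by simpa using hpm)
  · intro u huS hu hu0
    have hout : ∀ x, x ∉ Finset.univ.image T → u x = 0 := by
      intro x hx
      by_cases hxS : x ∈ S
      · exact hu0 x (Finset.mem_sdiff.2 ⟨hxS, hx⟩)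
      · exact huS x hxS
    have hker : ((N.submatrix J T).map (Int.cast : ℤ → ℝ)).mulVec (u ∘ T) = 0 := by
      ext k
      have h1 := hu (J k)
      rw [← Finset.sum_subset (Finset.subset_univ (Finset.univ.image T))
        (fun x _ hx => by rw [hout x hx, mul_zero]),
        Finset.sum_image (fun _ _ _ _ h => hTinj h)] at h1
      simpa [Matrix.mulVec, dotProduct] using h1
    have hdet : ((N.submatrix J T).map (Int.cast : ℤ → ℝ)).det ≠ 0 := by
      have := Int.cast_det (R := ℝ) (N.submatrix J T)
      rw [← this]
      exact_mod_cast hd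
    have hz := Matrix.eq_zero_of_mulVec_eq_zero hdet hker
    ext x
    by_cases hx : x ∈ Finset.univ.image T
    · obtain ⟨k, -, rfl⟩ := Finset.mem_image.1 hx
      exact congrFun hz k
    · exact hout x hx
  · intro s hs
    obtain ⟨hsS, hsR⟩ := Finset.mem_sdiff.1 hs
    have hsT : ∀ k, T k ≠ s := fun k hk =>
      hsR (Finset.mem_image.2 ⟨k, Finset.mem_univ _, hk⟩)
    have hT'inj : Function.Injective (T' s) :=
      Fin.cons_injective_iff.2 ⟨by rintro ⟨k, hk⟩; exact hsT k hk, hTinj⟩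
    have hval : ∀ k, (∑ l, if T' s l = T' s k then a s l else 0) = a s k := by
      intro k
      simp [hT'inj.eq_iff]
    refine ⟨?_, ?_, ?_, ?_, ?_⟩
    · have h0 := hval 0
      have h1 : T' s 0 = s := rfl
      rw [h1] at h0
      change (∑ l, if T' s l = s then a s l else 0) ≠ 0
      rw [h0]
      have h2 : T' s ∘ Fin.succ = T := by
        ext k; simp [T']
      simpa [a, h2] using hd
    · intro x hxs hxR
      refine Finset.sum_eq_zero fun k _ => if_neg ?_
      refine Fin.cases (fun h => hxs h.symm) (fun k h => hxR ?_) k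
      exact Finset.mem_image.2 ⟨k, Finset.mem_univ _, h⟩
    · intro x hx
      obtain ⟨k, -, rfl⟩ := Finset.mem_image.1 hx
      exact hTS k
    · intro i
      have hdet0 : (N.submatrix (Fin.cons i J) (T' s)).det = 0 := by
        by_contra hne
        exact hmax ⟨Fin.cons i J, T' s, Fin.cases hsS hTS, hne⟩
      rw [Matrix.det_succ_row_zero] at hdet0
      refine Eq.trans ?_ hdet0
      change ∑ x, N i x * (∑ k, if T' s k = x then a s k else 0) = _
      simp_rw [Finset.mul_sum]
      rw [Finset.sum_comm]
      refine Finset.sum_congr rfl fun k _ => ?_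
      simp only [mul_ite, mul_zero, Finset.sum_ite_eq, Finset.mem_univ, if_true, a,
        Matrix.submatrix_apply, Fin.cons_zero, Matrix.submatrix_submatrix]
      have : (Fin.cons i J : Fin (p + 1) → Fin m) ∘ Fin.succ = J := by ext; simp
      rw [this]
      ring
    · intro x
      by_cases hx : ∃ k, T' s k = x
      · obtain ⟨k, rfl⟩ := hx
        have hinj : Function.Injective (T' s ∘ k.succAbove) :=
          hT'inj.comp Fin.succAbove_right_injective
        refine ⟨Finset.univ.image (T' s ∘ k.succAbove), ?_, ?_, ?_⟩
        · intro hmem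
          obtain ⟨l, -, hl⟩ := Finset.mem_image.1 hmem
          exact Fin.succAbove_ne k l (hT'inj hl)
        · exact Finset.card_image_le.trans (by simpa using hpm)
        · change |∑ l, if T' s l = T' s k then a s l else 0| ≤ _
          rw [hval, Finset.prod_image (fun _ _ _ _ h => hinj h)]
          simp only [a, abs_mul, abs_pow, abs_neg, abs_one, one_pow, one_mul]
          refine (abs_det_le_factorial_mul_prod _ (fun l => β ((T' s ∘ k.succAbove) l))
            fun i j => hβ _ _).trans ?_
          refine mul_le_mul_of_nonneg_right ?_
            (Finset.prod_nonneg fun _ _ => by linarith [hβ1 ((T' s ∘ k.succAbove) ‹_›)])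
          exact_mod_cast Nat.factorial_le hpm
      · refine ⟨∅, by simp, by simp, ?_⟩
        change |∑ l, if T' s l = x then a s l else 0| ≤ _
        rw [Finset.sum_eq_zero fun k _ => if_neg fun h => hx ⟨k, h⟩]
        simp

/-- A polynomial with integer coefficients, not all zero, whose nonconstant coefficients are
bounded by `K`, has no root `δ` with `0 < δ ≤ 1` and `d K δ < 1`. -/
lemma add_sum_mul_pow_ne_zero {d : ℕ} (K δ : ℝ) (hδ0 : 0 < δ) (hδ1 : δ ≤ 1) (hK : 0 ≤ K)
    (p : ℤ) (z : Fin d → ℤ) (hz : ∀ s, |(z s : ℝ)| ≤ K) (hne : p ≠ 0 ∨ ∃ s, z s ≠ 0)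
    (hsmall : d * K * δ < 1) :
    (p : ℝ) + ∑ s : Fin d, (z s : ℝ) * δ ^ ((s : ℕ) + 1) ≠ 0 := by
  induction d generalizing p with
  | zero =>
    rcases hne with h | ⟨s, -⟩
    · simpa using h
    · exact s.elim0
  | succ d ih =>
    by_cases hp : p = 0
    · subst hp
      rw [Fin.sum_univ_succ]
      have hrec := ih (z 0) (fun s => z s.succ) (fun s => hz _) (by
        rcases hne with h | ⟨s, hs⟩
        · exact absurd rfl h
        · revert hs
          exact Fin.cases (fun h => Or.inl h) (fun s h => Or.inr ⟨s, h⟩) s) (by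
        push_cast at hsmall
        nlinarith [mul_nonneg hK hδ0.le])
      have hfac : ((0 : ℤ) : ℝ) + ((z 0 : ℝ) * δ ^ (((0 : Fin (d + 1)) : ℕ) + 1) +
          ∑ s : Fin d, (z s.succ : ℝ) * δ ^ ((s.succ : ℕ) + 1)) =
          δ * ((z 0 : ℝ) + ∑ s : Fin d, (z s.succ : ℝ) * δ ^ ((s : ℕ) + 1)) := by
        rw [mul_add, Finset.mul_sum]
        simp only [Int.cast_zero, zero_add, Fin.val_zero, pow_one, Fin.val_succ]
        congr 1
        · ring
        · exact Finset.sum_congr rfl fun s _ => by ring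
      rw [hfac]
      exact mul_ne_zero hδ0.ne' hrec
    · intro h0
      have h1 : (1 : ℝ) ≤ |(p : ℝ)| := by exact_mod_cast Int.one_le_abs hp
      have h2 : |∑ s : Fin (d + 1), (z s : ℝ) * δ ^ ((s : ℕ) + 1)| ≤
          ∑ _s : Fin (d + 1), K * δ := by
        refine (Finset.abs_sum_le_sum_abs _ _).trans (Finset.sum_le_sum fun s _ => ?_)
        rw [abs_mul, abs_of_pos (pow_pos hδ0 _)]
        refine mul_le_mul (hz s) ?_ (pow_pos hδ0 _).le hK
        exact pow_le_of_le_one hδ0.le hδ1 (by omega)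
      rw [eq_neg_of_add_eq_zero_left h0, abs_neg] at h1
      simp only [Finset.sum_const, Finset.card_univ, Fintype.card_fin, nsmul_eq_mul] at h2
      linarith

lemma convex_optimalFace {r d : ℕ} (M : Matrix (Fin r) (Fin d) ℝ) (b : Fin r → ℝ)
    (c : Fin d → ℝ) : Convex ℝ (OptimalFace M b c) := by
  rintro x ⟨⟨hx1, hx2⟩, hx3⟩ y ⟨⟨hy1, hy2⟩, hy3⟩ e f he hf hef
  have hsum : ∀ g : Fin d → ℝ, ∑ s, g s * (e • x + f • y) s =
      e * ∑ s, g s * x s + f * ∑ s, g s * y s := by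
    intro g
    rw [Finset.mul_sum, Finset.mul_sum, ← Finset.sum_add_distrib]
    exact Finset.sum_congr rfl fun s _ => by
      simp only [Pi.add_apply, Pi.smul_apply, smul_eq_mul]
      ring
  refine ⟨⟨fun i => ?_, fun s => ?_⟩, fun w hw => ?_⟩
  · rw [hsum, hx1, hy1, ← add_mul, hef, one_mul]
  · exact add_nonneg (mul_nonneg he (hx2 s)) (mul_nonneg hf (hy2 s))
  · rw [hsum]
    calc ∑ s, c s * w s = e * ∑ s, c s * w s + f * ∑ s, c s * w s := by
          rw [← add_mul, hef, one_mul]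
      _ ≤ _ := add_le_add (mul_le_mul_of_nonneg_left (hx3 w hw) he)
          (mul_le_mul_of_nonneg_left (hy3 w hw) hf)

/-- A vector of `ker M` supported on the coordinates that are positive somewhere on the optimal
face is orthogonal to the objective. -/
lemma sum_mul_eq_zero_of_support_optimalFace {r d : ℕ} (M : Matrix (Fin r) (Fin d) ℝ)
    (b : Fin r → ℝ) (c : Fin d → ℝ) (u : Fin d → ℝ) (hu : ∀ i, ∑ s, M i s * u s = 0)
    (hsupp : ∀ s, u s ≠ 0 → ∃ x ∈ OptimalFace M b c, 0 < x s) : ∑ s, c s * u s = 0 := by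
  classical
  set S : Finset (Fin d) := Finset.univ.filter fun s => u s ≠ 0 with hS
  by_cases hSe : S.Nonempty
  swap
  · rw [Finset.not_nonempty_iff_eq_empty] at hSe
    refine Finset.sum_eq_zero fun s _ => ?_
    have : s ∉ S := by simp [hSe]
    have : u s = 0 := by simpa [hS] using this
    simp [this]
  have hch : ∀ s : Fin d, ∃ x : Fin d → ℝ, s ∈ S → x ∈ OptimalFace M b c ∧ 0 < x s := by
    intro s
    by_cases hs : u s = 0
    · exact ⟨0, fun h => absurd hs (by simpa [hS] using h)⟩
    · obtain ⟨x, hx⟩ := hsupp s hs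
      exact ⟨x, fun _ => hx⟩
  choose X hX using hch
  have hcard : (0 : ℝ) < S.card := by exact_mod_cast hSe.card_pos
  obtain ⟨x, hx⟩ : ∃ x, x = ∑ s ∈ S, (S.card : ℝ)⁻¹ • X s := ⟨_, rfl⟩
  have hxF : x ∈ OptimalFace M b c := by
    rw [hx]
    refine (convex_optimalFace M b c).sum_mem (fun _ _ => by positivity) ?_ fun s hs => (hX s hs).1
    simp [hcard.ne']
  have hxpos : ∀ s, u s ≠ 0 → 0 < x s := by
    intro s hs
    have hsS : s ∈ S := by simpa [hS] using hs
    rw [hx, Finset.sum_apply]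
    refine Finset.sum_pos' (fun k hk => ?_) ⟨s, hsS, ?_⟩
    · exact mul_nonneg (by positivity) ((hX k hk).1.1.2 s)
    · exact mul_pos (by positivity) (hX s hsS).2
  obtain ⟨⟨hx1, hx2⟩, hx3⟩ := hxF
  have key : ∀ w : Fin d → ℝ, (∀ i, ∑ s, M i s * w s = 0) → (∀ s, w s ≠ 0 → 0 < x s) →
      ∑ s, c s * w s ≤ 0 := by
    intro w hw hwx
    have hev : ∀ᶠ δ in nhdsWithin (0 : ℝ) (Set.Ioi 0), ∀ s, 0 ≤ x s + δ * w s := by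
      rw [Filter.eventually_all]
      intro s
      by_cases hs : w s = 0
      · exact Filter.Eventually.of_forall fun δ => by simpa [hs] using hx2 s
      · have hcont : Filter.Tendsto (fun δ : ℝ => x s + δ * w s) (nhds 0) (nhds (x s + 0 * w s)) :=
          Continuous.tendsto (by fun_prop) 0
        rw [zero_mul, add_zero] at hcont
        exact ((hcont.eventually (lt_mem_nhds (hwx s hs))).filter_mono nhdsWithin_le_nhds).mono
          fun _ h => h.le
    obtain ⟨δ, hδ, hδ0⟩ := (hev.and self_mem_nhdsWithin).exists
    have hδ0 : 0 < δ := hδ0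
    have hsum : ∀ g : Fin d → ℝ, ∑ s, g s * (x s + δ * w s) =
        ∑ s, g s * x s + δ * ∑ s, g s * w s := by
      intro g
      rw [Finset.mul_sum, ← Finset.sum_add_distrib]
      exact Finset.sum_congr rfl fun s _ => by ring
    have h := hx3 (fun s => x s + δ * w s) ⟨fun i => by rw [hsum, hw, hx1]; ring, hδ⟩
    rw [hsum] at h
    by_contra! hpos
    linarith [mul_pos hδ0 hpos]
  refine le_antisymm (key u hu hxpos) ?_
  have h := key (-u) (fun i => by simpa using hu i) (fun s hs => hxpos s (by simpa using hs))
  simpa using h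

lemma mem_vectorSpan_optimalFace {r d : ℕ} (M : Matrix (Fin r) (Fin d) ℝ)
    (b : Fin r → ℝ) (c : Fin d → ℝ) (u : Fin d → ℝ) (hu : u ∈ vectorSpan ℝ (OptimalFace M b c)) :
    (∀ i, ∑ s, M i s * u s = 0) ∧ ∀ s, (∀ x ∈ OptimalFace M b c, ¬ 0 < x s) → u s = 0 := by
  rw [vectorSpan_def] at hu
  induction hu using Submodule.span_induction with
  | mem w hw =>
    obtain ⟨x, hx, y, hy, rfl⟩ := Set.mem_vsub.1 hw
    constructor
    · intro i
      have h1 := hx.1.1 i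
      have h2 := hy.1.1 i
      simp [mul_sub, Finset.sum_sub_distrib, h1, h2]
    · intro s hs
      have h1 := le_antisymm (not_lt.1 (hs x hx)) (hx.1.2 s)
      have h2 := le_antisymm (not_lt.1 (hs y hy)) (hy.1.2 s)
      simp [h1, h2]
  | zero => simp
  | add v w _ _ hv hw =>
    refine ⟨fun i => ?_, fun s hs => ?_⟩
    · simp [mul_add, Finset.sum_add_distrib, hv.1 i, hw.1 i]
    · simp [hv.2 s hs, hw.2 s hs]
  | smul a v _ hv =>
    refine ⟨fun i => ?_, fun s hs => ?_⟩
    · have h := hv.1 i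
      simp only [Pi.smul_apply, smul_eq_mul, mul_left_comm _ a, ← Finset.mul_sum, h, mul_zero]
    · simp [hv.2 s hs]

/-- A square integer matrix has a short nonzero integer combination of its columns all of whose
entries agree. -/
lemma exists_short_combination_const {q : ℕ} (hq : 0 < q) (A : Matrix (Fin q) (Fin q) ℤ) (B : ℤ)
    (hB : 1 ≤ B) (hA : ∀ i j, |A i j| ≤ B) :
    ∃ (w : Fin q → ℤ) (l : ℤ), (∃ j, w j ≠ 0) ∧ (∀ i, ∑ j, A i j * w j = l) ∧
      ∀ j, |w j| ≤ q.factorial * B ^ (q - 1) := by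
  classical
  let N : Matrix (Fin q) (Option (Fin q)) ℤ := fun i x => x.elim (-1) (A i)
  let β : Option (Fin q) → ℤ := fun x => x.elim 1 fun _ => B
  have hβ1 : ∀ x, 1 ≤ β x := by rintro (_ | x) <;> simp [β, hB]
  obtain ⟨R, v, hR, -, hv⟩ := exists_integral_circuits N β
    (by rintro i (_ | x) <;> simp [N, β, hA]) hβ1 Finset.univ
  obtain ⟨s, hs⟩ : ∃ s, s ∉ R := by
    by_contra! h
    have : R = Finset.univ := Finset.eq_univ_iff_forall.2 h
    rw [this, Finset.card_univ, Fintype.card_option, Fintype.card_fin] at hR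
    omega
  obtain ⟨hvs, -, -, hker, hbd⟩ := hv s (by simp [hs])
  have hrow : ∀ i, ∑ j, A i j * v s (some j) = v s none := by
    intro i
    have h := hker i
    rw [Fintype.sum_option] at h
    simp only [N, Option.elim] at h
    linarith
  refine ⟨fun j => v s (some j), v s none, ?_, hrow, fun j => ?_⟩
  · by_contra! h
    have h0 := hrow ⟨0, hq⟩
    simp only [h, mul_zero, Finset.sum_const_zero] at h0
    rcases s with _ | s
    · exact hvs h0.symm
    · exact hvs (h s)
  · obtain ⟨E, hE, -, hle⟩ := hbd (some j)
    refine hle.trans (mul_le_mul_of_nonneg_left ?_ (by positivity))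
    have hsub : E ⊆ Finset.univ.erase (some j) := fun x hx =>
      Finset.mem_erase.2 ⟨fun h => hE (h ▸ hx), Finset.mem_univ _⟩
    have h1 : ∏ y ∈ E, β y ≤ ∏ y ∈ Finset.univ.erase (some j), β y := by
      rw [← Finset.prod_sdiff hsub]
      refine le_mul_of_one_le_left (Finset.prod_nonneg fun y _ => by linarith [hβ1 y]) ?_
      simpa using Finset.prod_le_prod (s := Finset.univ.erase (some j) \ E)
        (f := fun _ => (1 : ℤ)) (fun _ _ => zero_le_one) fun y _ => hβ1 y
    refine h1.trans (le_of_eq ?_)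
    have h2 : B * ∏ y ∈ Finset.univ.erase (some j), β y = B * B ^ (q - 1) := by
      have h3 := Finset.mul_prod_erase Finset.univ β (Finset.mem_univ (some j))
      rw [Fintype.prod_option] at h3
      simp only [β, Option.elim, Finset.prod_const, Finset.card_univ, Fintype.card_fin,
        one_mul] at h3
      rw [← pow_succ', Nat.sub_add_cancel hq]
      exact h3
    exact mul_left_cancel₀ (by linarith) h2

/-- A space of vectors determined by their coordinates in `T` has dimension at most the size
of `T`. -/
lemma finrank_le_card_of_eq_zero {σ : Type*} [Fintype σ] (V : Submodule ℝ (σ → ℝ)) (T : Finset σ)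
    (h : ∀ u ∈ V, (∀ x ∈ T, u x = 0) → u = 0) : Module.finrank ℝ V ≤ T.card := by
  let f : V →ₗ[ℝ] (T → ℝ) := (LinearMap.funLeft ℝ ℝ ((↑) : T → σ)).comp V.subtype
  have hf : Function.Injective f := by
    rw [← LinearMap.ker_eq_bot, LinearMap.ker_eq_bot']
    intro u hu
    exact Subtype.ext (h u u.2 fun x hx => congrFun hu ⟨x, hx⟩)
  simpa using LinearMap.finrank_le_finrank_of_injective hf

/-- For integer data `c^1, …, c^q`, `M`, `b`, with `θ' = (q+1)!·((r+1)!)^q·‖C‖_∞^q·‖M‖_∞^{rq}`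
and `θ = max(2, θ')`, and any rational `0 < α < 1`, the explicit perturbations
`ε_s = (α/(dθ))^s`, `s ∈ [d]`, satisfy `0 < ε_s < α` and make the optimal face of the LP
`max c(t')·x s.t. Mx = b, x ≥ 0`, with `c_s(t') = Σ_i t'_i c^i_s + ε_s`, of affine dimension
at most `q − 1` for every `t'` in the standard simplex. (Here `‖C‖_∞` is the largest absolute
value of an entry of `C`, taken to be `1` when `C = 0`, and likewise for `‖M‖_∞`; since the
entries are integers this equals `max 1 (sup of absolute values of entries)`.) -/
theorem statement14 (q r d : ℕ) (c : Fin q → Fin d → ℤ) (M : Matrix (Fin r) (Fin d) ℤ)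
    (b : Fin r → ℤ)
    (Cnorm Mnorm θ' θ : ℕ)
    (hCnorm : Cnorm = max 1 (Finset.univ.sup fun p : Fin q × Fin d => (c p.1 p.2).natAbs))
    (hMnorm : Mnorm = max 1 (Finset.univ.sup fun p : Fin r × Fin d => (M p.1 p.2).natAbs))
    (hθ' : θ' = (q + 1).factorial * (r + 1).factorial ^ q * Cnorm ^ q * Mnorm ^ (r * q))
    (hθ : θ = max 2 θ')
    (α : ℚ) (hα0 : 0 < α) (hα1 : α < 1)
    (ε : Fin d → ℚ) (hε : ∀ s : Fin d, ε s = (α / (d * θ)) ^ ((s : ℕ) + 1)) :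
    (∀ s, 0 < ε s ∧ ε s < α) ∧
      ∀ t' : Fin q → ℝ, (∀ i, 0 ≤ t' i) → (∑ i, t' i = 1) →
        Module.finrank ℝ
          (affineSpan ℝ (OptimalFace (Matrix.of fun i s => ((M i s : ℤ) : ℝ))
            (fun i => ((b i : ℤ) : ℝ))
            (fun s => (∑ i, t' i * ((c i s : ℤ) : ℝ)) + ((ε s : ℚ) : ℝ)))).direction ≤
          q - 1 := by
  classical
  have hθ2 : 2 ≤ θ := hθ ▸ le_max_left _ _
  have hδ : 0 < d → 0 < α / (d * θ) ∧ α / (d * θ) ≤ α / 2 ∧ (d : ℚ) * θ * (α / (d * θ)) = α := by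
    intro hd
    have hd1 : (1 : ℚ) ≤ d := by exact_mod_cast hd
    have hθ2' : (2 : ℚ) ≤ θ := by exact_mod_cast hθ2
    refine ⟨by positivity, ?_, by field_simp⟩
    exact div_le_div_of_nonneg_left hα0.le (by norm_num) (by nlinarith)
  refine ⟨fun s => ?_, fun t' _ ht' => ?_⟩
  · obtain ⟨h0, h2, -⟩ := hδ s.pos
    rw [hε]
    refine ⟨by positivity, ?_⟩
    have := pow_le_of_le_one h0.le (by linarith) (Nat.succ_ne_zero (s : ℕ))
    exact lt_of_le_of_lt this (by linarith)
  rw [direction_affineSpan]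
  set F := OptimalFace (Matrix.of fun i s => ((M i s : ℤ) : ℝ)) (fun i => ((b i : ℤ) : ℝ))
    (fun s => (∑ i, t' i * ((c i s : ℤ) : ℝ)) + ((ε s : ℚ) : ℝ)) with hF
  by_contra! hdim
  have hq : 0 < q := by
    rcases Nat.eq_zero_or_pos q with rfl | h
    · simp at ht'
    · exact h
  have hC1 : 1 ≤ Cnorm := hCnorm ▸ le_max_left _ _
  have hM1 : 1 ≤ Mnorm := hMnorm ▸ le_max_left _ _
  have hC : ∀ i s, |c i s| ≤ Cnorm := by
    intro i s
    rw [Int.abs_eq_natAbs, hCnorm]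
    exact_mod_cast (Finset.le_sup (f := fun p : Fin q × Fin d => (c p.1 p.2).natAbs)
      (Finset.mem_univ (i, s))).trans (le_max_right _ _)
  have hM : ∀ i s, |M i s| ≤ Mnorm := by
    intro i s
    rw [Int.abs_eq_natAbs, hMnorm]
    exact_mod_cast (Finset.le_sup (f := fun p : Fin r × Fin d => (M p.1 p.2).natAbs)
      (Finset.mem_univ (i, s))).trans (le_max_right _ _)
  have hM1' : (1 : ℤ) ≤ Mnorm := by exact_mod_cast hM1
  have hC1' : (1 : ℤ) ≤ Cnorm := by exact_mod_cast hC1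
  obtain ⟨R, v, hR, hdet, hv⟩ := exists_integral_circuits M (fun _ => (Mnorm : ℤ)) hM
    (fun _ => hM1') (Finset.univ.filter fun s => ∃ x ∈ F, 0 < x s)
  set S : Finset (Fin d) := Finset.univ.filter fun s => ∃ x ∈ F, 0 < x s with hS
  have hcard : q ≤ (S \ R).card := by
    refine le_trans ?_ (finrank_le_card_of_eq_zero (vectorSpan ℝ F) (S \ R) fun u hu hu0 => ?_)
    · omega
    · obtain ⟨h1, h2⟩ := mem_vectorSpan_optimalFace _ _ _ u hu
      exact hdet u (fun x hx => h2 x (by simpa [hS] using hx)) h1 hu0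
  obtain ⟨f, hfinj, hf⟩ : ∃ f : Fin q → Fin d, Function.Injective f ∧ ∀ j, f j ∈ S \ R :=
    ⟨fun j => (S \ R).equivFin.symm (Fin.castLE hcard j),
      fun a b h => by simpa using h, fun j => Subtype.prop _⟩
  set L : ℤ := r.factorial * Mnorm ^ r with hL
  have hvL : ∀ j s, |v (f j) s| ≤ L := by
    intro j s
    obtain ⟨E, -, hE, hle⟩ := (hv _ (hf j)).2.2.2.2 s
    refine hle.trans (mul_le_mul_of_nonneg_left ?_ (by positivity))
    rw [Finset.prod_const]
    exact pow_le_pow_right₀ hM1' hE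
  have hvsupp : ∀ j s, s ∉ insert (f j) R → v (f j) s = 0 := by
    intro j s hs
    rw [Finset.mem_insert, not_or] at hs
    exact (hv _ (hf j)).2.1 s hs.1 hs.2
  have hL1 : 1 ≤ L := by
    have : 1 ≤ r.factorial * Mnorm ^ r := Nat.mul_pos r.factorial_pos (pow_pos hM1 _)
    rw [hL]
    exact_mod_cast this
  set B : ℤ := (r + 1) * Cnorm * L with hB
  have hLB : L ≤ B := by
    rw [hB]
    exact le_mul_of_one_le_left (by linarith) (by nlinarith)
  have hA : ∀ i j, |∑ s, c i s * v (f j) s| ≤ B := by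
    intro i j
    rw [← Finset.sum_subset (Finset.subset_univ (insert (f j) R))
      (fun s _ hs => by rw [hvsupp j s hs, mul_zero])]
    calc |∑ s ∈ insert (f j) R, c i s * v (f j) s|
        ≤ ∑ s ∈ insert (f j) R, |c i s * v (f j) s| := Finset.abs_sum_le_sum_abs _ _
      _ ≤ ∑ _s ∈ insert (f j) R, Cnorm * L := by
          refine Finset.sum_le_sum fun s _ => ?_
          rw [abs_mul]
          exact mul_le_mul (hC i s) (hvL j s) (abs_nonneg _) (by linarith)
      _ ≤ B := by
          rw [Finset.sum_const, nsmul_eq_mul, hB, mul_assoc]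
          refine mul_le_mul_of_nonneg_right ?_ (by positivity)
          exact_mod_cast (Finset.card_insert_le _ _).trans (Nat.succ_le_succ hR)
  obtain ⟨w, l, ⟨j₀, hj₀⟩, hw, hwbd⟩ := exists_short_combination_const hq
    (fun i j => ∑ s, c i s * v (f j) s) B (hL1.trans hLB) hA
  have hd : 0 < d := (f j₀).pos
  obtain ⟨hδ0, hδ2, hδθ⟩ := hδ hd
  have hz : ∀ s, |∑ j, w j * v (f j) s| ≤ θ := by
    intro s
    have h1 : |∑ j, w j * v (f j) s| ≤ ∑ _j : Fin q, q.factorial * B ^ (q - 1) * L := by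
      refine (Finset.abs_sum_le_sum_abs _ _).trans (Finset.sum_le_sum fun j _ => ?_)
      rw [abs_mul]
      exact mul_le_mul (hwbd j) (hvL j s) (abs_nonneg _) (by positivity)
    have h2 : B ^ (q - 1) * L ≤ B ^ q := by
      calc B ^ (q - 1) * L ≤ B ^ (q - 1) * B := mul_le_mul_of_nonneg_left hLB (by positivity)
        _ = B ^ q := by rw [← pow_succ, Nat.sub_add_cancel hq]
    have h3 : (θ' : ℤ) = (q + 1) * (q.factorial * B ^ q) := by
      rw [hθ', hB, hL, Nat.factorial_succ, Nat.factorial_succ]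
      push_cast
      rw [pow_mul, mul_pow, mul_pow, mul_pow, mul_pow]
      ring
    have h4 : (θ' : ℤ) ≤ θ := by exact_mod_cast hθ ▸ le_max_right _ _
    rw [Finset.sum_const, Finset.card_univ, Fintype.card_fin, nsmul_eq_mul, mul_assoc] at h1
    have h5 : (q.factorial : ℤ) * (B ^ (q - 1) * L) ≤ q.factorial * B ^ q :=
      mul_le_mul_of_nonneg_left h2 (by positivity)
    have h6 : (0 : ℤ) ≤ q.factorial * B ^ q := by positivity
    nlinarith
  have hzne : ∑ j, w j * v (f j) (f j₀) ≠ 0 := by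
    rw [Finset.sum_eq_single j₀]
    · exact mul_ne_zero hj₀ (hv _ (hf j₀)).1
    · intro j _ hj
      rw [(hv _ (hf j)).2.1 _ (hfinj.ne hj.symm) (Finset.mem_sdiff.1 (hf j₀)).2, mul_zero]
    · simp
  have horth : ∀ j, ∑ s, ((∑ i, t' i * (c i s : ℝ)) + (ε s : ℝ)) * (v (f j) s : ℝ) = 0 := by
    intro j
    obtain ⟨-, -, hRS, hker, -⟩ := hv _ (hf j)
    refine sum_mul_eq_zero_of_support_optimalFace (Matrix.of fun i s => ((M i s : ℤ) : ℝ))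
      (fun i => ((b i : ℤ) : ℝ)) _ _ (fun i => ?_) fun s hs => ?_
    · simp only [Matrix.of_apply]
      exact_mod_cast hker i
    · have hmem : s ∈ insert (f j) R := by
        by_contra h
        exact hs (by rw [hvsupp j s h, Int.cast_zero])
      have hsS : s ∈ S := by
        rcases Finset.mem_insert.1 hmem with rfl | h
        · exact (Finset.mem_sdiff.1 (hf j)).1
        · exact hRS h
      simpa [hS] using hsS
  refine add_sum_mul_pow_ne_zero (θ : ℝ) ((α / (d * θ) : ℚ) : ℝ) (by exact_mod_cast hδ0)
    (by exact_mod_cast (by linarith : α / (d * θ) ≤ 1)) (by positivity) l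
    (fun s => ∑ j, w j * v (f j) s) (fun s => by exact_mod_cast hz s)
    (Or.inr ⟨f j₀, hzne⟩) (by exact_mod_cast (by linarith : (d : ℚ) * θ * (α / (d * θ)) < 1)) ?_
  have hlw : (l : ℝ) = ∑ j, (w j : ℝ) * ∑ s, (∑ i, t' i * (c i s : ℝ)) * (v (f j) s : ℝ) := by
    calc (l : ℝ) = ∑ i, t' i * (l : ℝ) := by rw [← Finset.sum_mul, ht', one_mul]
      _ = ∑ i, t' i * ∑ j, (∑ s, (c i s : ℝ) * (v (f j) s : ℝ)) * (w j : ℝ) := by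
          refine Finset.sum_congr rfl fun i _ => ?_
          rw [← hw i]
          push_cast
          rfl
      _ = _ := by
          simp_rw [Finset.mul_sum, Finset.sum_mul, Finset.mul_sum]
          rw [Finset.sum_comm]
          refine Finset.sum_congr rfl fun j _ => ?_
          rw [Finset.sum_comm]
          exact Finset.sum_congr rfl fun s _ => Finset.sum_congr rfl fun i _ => by ring
  have hεw : ∑ s, ((∑ j, w j * v (f j) s : ℤ) : ℝ) * ((α / (d * θ) : ℚ) : ℝ) ^ ((s : ℕ) + 1) =
      ∑ j, (w j : ℝ) * ∑ s, (ε s : ℝ) * (v (f j) s : ℝ) := by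
    simp_rw [Finset.mul_sum]
    rw [Finset.sum_comm]
    refine Finset.sum_congr rfl fun s _ => ?_
    rw [hε]
    push_cast
    rw [Finset.sum_mul]
    exact Finset.sum_congr rfl fun j _ => by ring
  rw [hlw, hεw, ← Finset.sum_add_distrib]
  refine Finset.sum_eq_zero fun j _ => ?_
  rw [← mul_add, ← Finset.sum_add_distrib]
  simp_rw [← add_mul]
  rw [horth j, mul_zero]
end
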